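/- Let (X,d) be a finite metric space with |X| ≥ 2, let q > 0, and let c(x,y) := d(x,y)^q. Then r*_c(P(X)) < 7.56·(|X| − 1)^q. -/

import Mathlib

open MeasureTheory ENNReal

noncomputable section

/-- The optimal transport cost `C*_c(P,Q)` between two Borel measures for the cost `c`:
the infimum of `∫ c dγ` over couplings `γ` of `(P, Q)`. -/
def Cstar {X : Type*} [MeasurableSpace X] (c : X → X → ℝ) (P Q : Measure X) : ℝ≥0∞ :=
  ⨅ γ ∈ {γ : Measure (X × X) |
      IsProbabilityMeasure γ ∧ γ.map Prod.fst = P ∧ γ.map Prod.snd = Q},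
    ∫⁻ z, ENNReal.ofReal (c z.1 z.2) ∂γ

/-- The standard probability space: `[0,1]` with Lebesgue measure. -/
def stdSpace : Measure ℝ := volume.restrict (Set.Icc (0 : ℝ) 1)

/-- `f` is a coupling of the family of probability measures `P` on the standard
probability space `([0,1], Lebesgue)`: each `f a` is measurable with law `P a`. -/
structure IsCoupling {X A : Type*} [MeasurableSpace X]
    (P : A → Measure X) (f : A → ℝ → X) : Prop where
  measurable : ∀ a, Measurable (f a)
  law : ∀ a, stdSpace.map (f a) = P a

/-- The pairwise coupling ratio `r_c({X_α})` of a coupling `f` of the family `P`: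
the least `r ≥ 1` such that `E[c(X_a, X_b)] ≤ r ⬝ C*_c(P_a, P_b)` for all `a, b`
(`∞` if no such `r` exists). -/
def couplingRatio {X A : Type*} [MeasurableSpace X]
    (c : X → X → ℝ) (P : A → Measure X) (f : A → ℝ → X) : ℝ≥0∞ :=
  sInf {r : ℝ≥0∞ | 1 ≤ r ∧ ∀ a b : A,
    ∫⁻ u, ENNReal.ofReal (c (f a u) (f b u)) ∂stdSpace ≤ r * Cstar c (P a) (P b)}

/-- The optimal pairwise coupling ratio `r*_c({P_α})` of a family of probability
measures: the infimum of `r_c({X_α})` over all couplings of the family. -/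
def optRatio {X A : Type*} [MeasurableSpace X]
    (c : X → X → ℝ) (P : A → Measure X) : ℝ≥0∞ :=
  ⨅ (f : A → ℝ → X) (_ : IsCoupling P f), couplingRatio c P f

section Couplings

open Set

instance : IsProbabilityMeasure stdSpace := by
  constructor
  simp [stdSpace]

theorem stdSpace_real_Ico {a b : ℝ} (ha : 0 ≤ a) (hab : a ≤ b) (hb : b ≤ 1) :
    stdSpace.real (Ico a b) = b - a := by
  have h : Ico a b ∩ Icc 0 1 = Ico a b :=
    inter_eq_left.2 fun x hx => ⟨ha.trans hx.1, hx.2.le.trans hb⟩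
  rw [stdSpace, measureReal_restrict_apply measurableSet_Ico, h, Real.volume_real_Ico_of_le hab]

theorem symmDiff_Ico_subset (a b a' b' : ℝ) :
    symmDiff (Ico a b) (Ico a' b') ⊆ uIcc a a' ∪ uIcc b b' := by
  intro x hx
  simp only [mem_symmDiff, mem_Ico, mem_union, mem_uIcc] at *
  grind

theorem stdSpace_real_symmDiff_Ico_le (a b a' b' : ℝ) :
    stdSpace.real (symmDiff (Ico a b) (Ico a' b')) ≤ |a - a'| + |b - b'| := by
  have h (x y : ℝ) : stdSpace.real (uIcc x y) ≤ |x - y| := by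
    calc stdSpace.real (uIcc x y) ≤ volume.real (uIcc x y) :=
          ENNReal.toReal_mono (by simp) (Measure.restrict_apply_le _ _)
      _ = |x - y| := by
          rw [measureReal_def, Real.volume_interval, ENNReal.toReal_ofReal (abs_nonneg _),
            abs_sub_comm]
  calc _ ≤ stdSpace.real (uIcc a a' ∪ uIcc b b') := measureReal_mono (symmDiff_Ico_subset ..)
    _ ≤ _ := measureReal_union_le _ _
    _ ≤ _ := add_le_add (h _ _) (h _ _)

open Classical in
/-- Read the point whose cell contains the first coordinate, and fall back on `f` if there is
no such cell. -/
def pick {X Ω : Type*} (I : X → Set ℝ) (f : Ω → X) (z : ℝ × Ω) : X :=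
  if h : ∃ x, z.1 ∈ I x then h.choose else f z.2

section Pick

variable {X Ω : Type*} {I J : X → Set ℝ} {f g : Ω → X}

theorem pick_of_mem (hI : Pairwise fun x y => Disjoint (I x) (I y)) {z : ℝ × Ω} {x : X}
    (hx : z.1 ∈ I x) : pick I f z = x := by
  have h : ∃ x, z.1 ∈ I x := ⟨x, hx⟩
  rw [pick, dif_pos h]
  by_contra hne
  exact Set.disjoint_left.1 (hI hne) h.choose_spec hx

theorem pick_of_notMem {z : ℝ × Ω} (hz : z.1 ∉ ⋃ x, I x) : pick I f z = f z.2 := by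
  rw [pick, dif_neg (by simpa using hz)]

theorem preimage_pick (hI : Pairwise fun x y => Disjoint (I x) (I y)) (x : X) :
    pick I f ⁻¹' {x} = I x ×ˢ univ ∪ (⋃ y, I y)ᶜ ×ˢ (f ⁻¹' {x}) := by
  ext z
  by_cases hz : z.1 ∈ ⋃ y, I y
  · obtain ⟨y, hy⟩ := mem_iUnion.1 hz
    simp only [mem_preimage, pick_of_mem hI hy, mem_union, mem_prod, mem_compl_iff, hz]
    simp only [mem_singleton_iff, mem_univ, and_true, not_true_eq_false, false_and, or_false]
    constructor
    · rintro rfl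
      exact hy
    · intro hx
      by_contra hne
      exact Set.disjoint_left.1 (hI hne) hy hx
  · have hx : z.1 ∉ I x := fun h => hz (mem_iUnion.2 ⟨x, h⟩)
    simp only [mem_preimage, pick_of_notMem hz, mem_union, mem_prod, hx, mem_compl_iff, hz]
    simp

variable [Fintype X] [MeasurableSpace Ω] {μ : Measure Ω} [IsProbabilityMeasure μ]

theorem real_pick_ne_le (hI : Pairwise fun x y => Disjoint (I x) (I y))
    (hJ : Pairwise fun x y => Disjoint (J x) (J y)) (hm : ∀ x, MeasurableSet (I x)) :
    (stdSpace.prod μ).real {z | pick I f z ≠ pick J g z}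
      ≤ (∑ x, stdSpace.real (symmDiff (I x) (J x)))
        + (1 - ∑ y, stdSpace.real (I y)) * μ.real {ω | f ω ≠ g ω} := by
  have hsub : {z | pick I f z ≠ pick J g z} ⊆
      (⋃ x, symmDiff (I x) (J x) ×ˢ univ) ∪ (⋃ y, I y)ᶜ ×ˢ {ω | f ω ≠ g ω} := by
    intro z hz
    simp only [mem_ofPred_eq, mem_union, mem_iUnion, mem_prod, mem_univ, and_true] at *
    by_cases h1 : z.1 ∈ ⋃ y, I y
    · obtain ⟨x, hx⟩ := mem_iUnion.1 h1
      refine .inl ⟨x, .inl ⟨hx, fun hx' => hz ?_⟩⟩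
      rw [pick_of_mem hI hx, pick_of_mem hJ hx']
    · by_cases h2 : z.1 ∈ ⋃ y, J y
      · obtain ⟨x, hx⟩ := mem_iUnion.1 h2
        exact .inl ⟨x, .inr ⟨hx, fun hx' => h1 (mem_iUnion.2 ⟨x, hx'⟩)⟩⟩
      · rw [pick_of_notMem h1, pick_of_notMem h2] at hz
        exact .inr ⟨h1, hz⟩
  calc _ ≤ _ := measureReal_mono hsub
    _ ≤ _ := measureReal_union_le _ _
    _ ≤ _ := by
      gcongr
      · refine (measureReal_iUnion_fintype_le _).trans (le_of_eq ?_)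
        simp [measureReal_prod_prod]
      · rw [measureReal_prod_prod, probReal_compl_eq_one_sub (MeasurableSet.iUnion hm),
          measureReal_iUnion_fintype (fun x y h => hI h) hm]

variable [MeasurableSpace X] [MeasurableSingletonClass X]

theorem measurable_pick (hI : Pairwise fun x y => Disjoint (I x) (I y))
    (hm : ∀ x, MeasurableSet (I x)) (hf : Measurable f) : Measurable (pick I f) := by
  refine measurable_to_countable' fun x => ?_
  rw [preimage_pick hI]
  exact ((hm x).prod .univ).union ((MeasurableSet.iUnion hm).compl.prod (hf (.singleton x)))

theorem real_preimage_pick (hI : Pairwise fun x y => Disjoint (I x) (I y))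
    (hm : ∀ x, MeasurableSet (I x)) (hf : Measurable f) (x : X) :
    (stdSpace.prod μ).real (pick I f ⁻¹' {x})
      = stdSpace.real (I x) + (1 - ∑ y, stdSpace.real (I y)) * μ.real (f ⁻¹' {x}) := by
  rw [preimage_pick hI, measureReal_union, measureReal_prod_prod, measureReal_prod_prod,
    probReal_univ, mul_one, probReal_compl_eq_one_sub (MeasurableSet.iUnion hm),
    measureReal_iUnion_fintype (fun x y h => hI h) hm]
  · exact Disjoint.set_prod_left (disjoint_compl_right.mono_left (subset_iUnion I x)) _ _
  · exact (MeasurableSet.iUnion hm).compl.prod (hf (.singleton x))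

end Pick

/-- `S` samples, from one source of randomness, all probability vectors on `X` at once, in such a
way that the samples of `p` and `q` differ with probability at most `C * ‖p - q‖₁`. -/
structure IsSampler {X Ω : Type*} [Fintype X] [MeasurableSpace X] [MeasurableSpace Ω]
    (μ : Measure Ω) (S : stdSimplex ℝ X → Ω → X) (C : ℝ) : Prop where
  measurable : ∀ p, Measurable (S p)
  support : ∀ (p : stdSimplex ℝ X) ω, p (S p ω) ≠ 0
  law : ∀ (p : stdSimplex ℝ X) x, μ.real (S p ⁻¹' {x}) = p x
  ne_le : ∀ p q : stdSimplex ℝ X, μ.real {ω | S p ω ≠ S q ω} ≤ C * ∑ x, |p x - q x|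

theorem exists_apply_ne_zero {X : Type*} [Fintype X] (p : stdSimplex ℝ X) : ∃ x, p x ≠ 0 := by
  by_contra! h
  simpa [h] using stdSimplex.sum_eq_one p

section Sampler

variable {X : Type*} [Fintype X] [MeasurableSpace X] [MeasurableSingletonClass X]

theorem isSampler_pick {Ω : Type*} [MeasurableSpace Ω] {μ : Measure Ω} [IsProbabilityMeasure μ]
    {S : stdSimplex ℝ X → Ω → X} {a : stdSimplex ℝ X → X → ℝ} {l B C : ℝ}
    (ha : ∀ p x, 0 ≤ a p x) (hl : 0 ≤ l) (ha1 : ∀ (p : stdSimplex ℝ X) x, a p x + l * p x ≤ 1)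
    (hdisj : ∀ p : stdSimplex ℝ X, Pairwise fun x y =>
      Disjoint (Ico (a p x) (a p x + l * p x)) (Ico (a p y) (a p y + l * p y)))
    (hB : ∀ p q : stdSimplex ℝ X, ∑ x, (|a p x - a q x| + |(a p x + l * p x) - (a q x + l * q x)|)
      ≤ B * ∑ x, |p x - q x|)
    (hSm : ∀ p, Measurable (S p)) (hSs : ∀ (p : stdSimplex ℝ X) ω, p (S p ω) ≠ 0)
    (hSl : l = 1 ∨ ∀ (p : stdSimplex ℝ X) x, μ.real (S p ⁻¹' {x}) = p x)
    (hSn : l = 1 ∨ l ≤ 1 ∧ ∀ p q : stdSimplex ℝ X,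
      μ.real {ω | S p ω ≠ S q ω} ≤ C * ∑ x, |p x - q x|) :
    IsSampler (stdSpace.prod μ) (fun p => pick (fun x => Ico (a p x) (a p x + l * p x)) (S p))
      (B + (1 - l) * C) := by
  have hlen (p : stdSimplex ℝ X) (x : X) :
      stdSpace.real (Ico (a p x) (a p x + l * p x)) = l * p x := by
    rw [stdSpace_real_Ico (ha p x)
      (by simpa using mul_nonneg hl (stdSimplex.zero_le p x)) (ha1 p x)]
    ring
  have hsum (p : stdSimplex ℝ X) :
      ∑ x, stdSpace.real (Ico (a p x) (a p x + l * p x)) = l := by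
    simp_rw [hlen, ← Finset.mul_sum]
    rw [stdSimplex.sum_eq_one, mul_one]
  refine ⟨fun p => measurable_pick (hdisj p) (fun _ => measurableSet_Ico) (hSm p), ?_, ?_, ?_⟩
  · intro p z
    by_cases hz : z.1 ∈ ⋃ x, Ico (a p x) (a p x + l * p x)
    · obtain ⟨x, hx⟩ := mem_iUnion.1 hz
      rw [pick_of_mem (hdisj p) hx]
      intro h0
      simp [h0] at hx
    · rw [pick_of_notMem hz]
      exact hSs p z.2
  · intro p x
    rw [real_preimage_pick (hdisj p) (fun _ => measurableSet_Ico) (hSm p), hsum, hlen]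
    rcases hSl with rfl | h
    · ring
    · rw [h]
      ring
  · intro p q
    refine (real_pick_ne_le (hdisj p) (hdisj q) fun _ => measurableSet_Ico).trans ?_
    rw [hsum, add_mul]
    refine add_le_add ((Finset.sum_le_sum fun x _ =>
      stdSpace_real_symmDiff_Ico_le _ _ _ _).trans (hB p q)) ?_
    rcases hSn with rfl | ⟨hl1, h⟩
    · simp
    · rw [mul_assoc]
      exact mul_le_mul_of_nonneg_left (h p q) (by linarith)

theorem IsSampler.exists_quantile :
    ∃ S : stdSimplex ℝ X → ℝ × Unit → X,
      IsSampler (stdSpace.prod (Measure.dirac ())) S (2 * Fintype.card X) := by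
  classical
  let e := Fintype.equivFin X
  let F (p : stdSimplex ℝ X) (x : X) : ℝ := ∑ y with e y < e x, p y
  have hF (p : stdSimplex ℝ X) (x : X) : F p x + 1 * p x = ∑ y with e y ≤ e x, p y := by
    have : ({y | e y ≤ e x} : Finset X) = insert x ({y | e y < e x} : Finset X) := by
      ext y
      simp [le_iff_eq_or_lt]
    rw [this, Finset.sum_insert (by simp)]
    simp only [F]
    ring
  have hp (p : stdSimplex ℝ X) (x : X) : 0 ≤ p x := stdSimplex.zero_le p x
  have habs (p q : stdSimplex ℝ X) (s : Finset X) :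
      |∑ y ∈ s, p y - ∑ y ∈ s, q y| ≤ ∑ x, |p x - q x| := by
    rw [← Finset.sum_sub_distrib]
    exact (Finset.abs_sum_le_sum_abs _ _).trans
      (Finset.sum_le_univ_sum_of_nonneg fun _ => abs_nonneg _)
  have hlt (p : stdSimplex ℝ X) {x y : X} (h : e x < e y) : F p x + 1 * p x ≤ F p y := by
    rw [hF]
    refine Finset.sum_le_sum_of_subset_of_nonneg (fun z hz => ?_) fun z _ _ => hp p z
    simp only [Finset.mem_filter, Finset.mem_univ, true_and] at *
    exact hz.trans_lt h
  have key := isSampler_pick (μ := Measure.dirac ()) (a := F) (l := 1) (C := 0)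
    (B := 2 * Fintype.card X) (S := fun p _ => (exists_apply_ne_zero p).choose)
    (fun p x => Finset.sum_nonneg fun y _ => hp p y) zero_le_one
    (fun p x => ?_) (fun p x y hxy => ?_) (fun p q => ?_) (fun p => measurable_const)
    (fun p _ => (exists_apply_ne_zero p).choose_spec) (.inl rfl) (.inl rfl)
  · exact ⟨_, by simpa using key⟩
  · rw [hF]
    refine (Finset.sum_le_univ_sum_of_nonneg (hp p)).trans (stdSimplex.sum_eq_one p).le
  · refine Set.disjoint_left.2 ?_
    rintro u ⟨h1, h2⟩ ⟨h3, h4⟩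
    rcases lt_or_gt_of_ne (e.injective.ne hxy) with h | h
    · linarith [hlt p h]
    · linarith [hlt p h]
  · simp_rw [hF]
    refine (Finset.sum_le_card_nsmul _ _ (2 * ∑ x, |p x - q x|) fun x _ => ?_).trans
      (le_of_eq ?_)
    · rw [two_mul]
      exact add_le_add (habs _ _ _) (habs _ _ _)
    · simp
      ring

theorem IsSampler.exists_rejection {Ω : Type*} [MeasurableSpace Ω] {μ : Measure Ω}
    [IsProbabilityMeasure μ] {S : stdSimplex ℝ X → Ω → X} {C : ℝ} [Nonempty X]
    (hS : IsSampler μ S C) :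
    ∃ S' : stdSimplex ℝ X → ℝ × Ω → X, IsSampler (stdSpace.prod μ) S'
      ((Fintype.card X : ℝ)⁻¹ + (1 - (Fintype.card X : ℝ)⁻¹) * C) := by
  let e := Fintype.equivFin X
  set n : ℝ := (Fintype.card X : ℝ) with hn
  have hn0 : 0 < n := by
    rw [hn]
    exact_mod_cast Fintype.card_pos
  have hn1 : 1 ≤ n := by
    rw [hn]
    exact_mod_cast Fintype.card_pos
  have hlt (p : stdSimplex ℝ X) {x y : X} (h : e x < e y) :
      (e x : ℝ) / n + n⁻¹ * p x ≤ (e y : ℝ) / n := by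
    have h1 : ((e x : ℕ) : ℝ) + 1 ≤ (e y : ℕ) := by exact_mod_cast h
    calc (e x : ℝ) / n + n⁻¹ * p x ≤ (e x : ℝ) / n + n⁻¹ * 1 := by
          gcongr
          exact stdSimplex.le_one p x
      _ = ((e x : ℕ) + 1) / n := by field_simp
      _ ≤ _ := by gcongr
  refine ⟨_, isSampler_pick (a := fun _ x => (e x : ℝ) / n) (l := n⁻¹) (B := n⁻¹)
    (fun p x => by positivity) (by positivity) (fun p x => ?_) (fun p x y hxy => ?_)
    (fun p q => ?_) hS.measurable hS.support (.inr hS.law)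
    (.inr ⟨inv_le_one_of_one_le₀ hn1, hS.ne_le⟩)⟩
  · have h1 : ((e x : ℕ) : ℝ) + 1 ≤ n := by
      rw [hn]
      exact_mod_cast Nat.succ_le_of_lt (e x).2
    calc (e x : ℝ) / n + n⁻¹ * p x ≤ (e x : ℝ) / n + n⁻¹ * 1 := by
          gcongr
          exact stdSimplex.le_one p x
      _ = ((e x : ℕ) + 1) / n := by field_simp
      _ ≤ 1 := (div_le_one hn0).2 h1
  · refine Set.disjoint_left.2 ?_
    rintro u ⟨h1, h2⟩ ⟨h3, h4⟩
    rcases lt_or_gt_of_ne (e.injective.ne hxy) with h | h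
    · linarith [hlt p h]
    · linarith [hlt p h]
  · simp only [sub_self, abs_zero, zero_add, add_sub_add_left_eq_sub, ← mul_sub, abs_mul,
      abs_of_pos (inv_pos.2 hn0), ← Finset.mul_sum, le_refl]

/-- On a finite set, the maximal couplings of all pairs of probability vectors can be realized
simultaneously up to a factor arbitrarily close to `2` (as `‖p - q‖₁` is twice the total
variation distance). -/
theorem IsSampler.exists_of_one_lt [Nonempty X] {C : ℝ} (hC : 1 < C) :
    ∃ (Ω : Type) (_ : MeasurableSpace Ω) (_ : StandardBorelSpace Ω) (μ : Measure Ω)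
      (_ : IsProbabilityMeasure μ) (S : stdSimplex ℝ X → Ω → X), IsSampler μ S C := by
  set n : ℝ := (Fintype.card X : ℝ) with hn
  have hn1 : 1 ≤ n := by
    rw [hn]
    exact_mod_cast Fintype.card_pos
  have iter (k : ℕ) : ∃ (Ω : Type) (_ : MeasurableSpace Ω) (_ : StandardBorelSpace Ω)
      (μ : Measure Ω) (_ : IsProbabilityMeasure μ) (S : stdSimplex ℝ X → Ω → X),
      IsSampler μ S (1 + (1 - n⁻¹) ^ k * (2 * n - 1)) := by
    induction k with
    | zero =>
      obtain ⟨S, hS⟩ := IsSampler.exists_quantile (X := X)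
      exact ⟨ℝ × Unit, inferInstance, inferInstance, stdSpace.prod (Measure.dirac ()),
        inferInstance, S, by simpa [hn] using hS⟩
    | succ k ih =>
      obtain ⟨Ω, _, _, μ, _, S, hS⟩ := ih
      obtain ⟨S', hS'⟩ := hS.exists_rejection
      refine ⟨ℝ × Ω, inferInstance, inferInstance, stdSpace.prod μ, inferInstance, S', ?_⟩
      convert hS' using 1
      rw [← hn]
      ring
  have hr0 : 0 ≤ 1 - n⁻¹ := sub_nonneg.2 (inv_le_one_of_one_le₀ hn1)
  have hr1 : 1 - n⁻¹ < 1 := by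
    have : 0 < n⁻¹ := by positivity
    linarith
  obtain ⟨k, hk⟩ := (((tendsto_pow_atTop_nhds_zero_of_lt_one hr0 hr1).mul_const
    (2 * n - 1)).eventually_lt_const (by linarith : 0 * (2 * n - 1) < C - 1)).exists
  obtain ⟨Ω, _, _, μ, _, S, hS⟩ := iter k
  refine ⟨Ω, _, inferInstance, μ, inferInstance, S, hS.measurable, hS.support, hS.law, ?_⟩
  intro p q
  refine (hS.ne_le p q).trans (mul_le_mul_of_nonneg_right (by linarith) ?_)
  exact Finset.sum_nonneg fun _ _ => abs_nonneg _

end Sampler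

section Refinement

variable {X : Type*} [Fintype X]

open Classical in
theorem stdSimplex_map_apply (L : X → X) (p : stdSimplex ℝ X) (v : X) :
    stdSimplex.map L p v = ∑ x with L x = v, p x := by
  rw [stdSimplex.map_coe, FunOnFinite.linearMap_apply_apply]

theorem stdSimplex_map_map_of_comp {L L' : X → X} (h : ∀ x, L (L' x) = L x)
    (p : stdSimplex ℝ X) : stdSimplex.map L (stdSimplex.map L' p) = stdSimplex.map L p := by
  rw [stdSimplex.map_comp_apply]
  congr 1
  exact funext h

theorem le_stdSimplex_map (L : X → X) (p : stdSimplex ℝ X) (x : X) :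
    p x ≤ stdSimplex.map L p (L x) := by
  classical
  rw [stdSimplex_map_apply]
  exact Finset.single_le_sum (fun y _ => stdSimplex.zero_le p y) (by simp)

open Classical in
/-- The probability vector `p` conditioned on the fiber of `L` over `v` (and `p` itself if that
fiber is negligible). -/
def fiberCond (L : X → X) (p : stdSimplex ℝ X) (v : X) : stdSimplex ℝ X :=
  if h : stdSimplex.map L p v ≠ 0 then
    ⟨fun x => if L x = v then p x / stdSimplex.map L p v else 0, fun x => by
      dsimp only
      split_ifs
      · exact div_nonneg (stdSimplex.zero_le _ _) (stdSimplex.zero_le _ _)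
      · exact le_rfl, by
      rw [← Finset.sum_filter, ← Finset.sum_div, ← stdSimplex_map_apply, div_self h]⟩
  else p

open Classical in
theorem fiberCond_apply {L : X → X} {p : stdSimplex ℝ X} {v : X} (h : stdSimplex.map L p v ≠ 0)
    (x : X) : fiberCond L p v x = if L x = v then p x / stdSimplex.map L p v else 0 := by
  rw [fiberCond, dif_pos h]
  rfl

open Classical in
theorem stdSimplex_map_mul_fiberCond (L : X → X) (p : stdSimplex ℝ X) (v x : X) :
    stdSimplex.map L p v * fiberCond L p v x = if L x = v then p x else 0 := by
  by_cases h : stdSimplex.map L p v = 0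
  · rw [h, zero_mul]
    split_ifs with hx
    · have := le_stdSimplex_map L p x
      rw [hx, h] at this
      exact le_antisymm (stdSimplex.zero_le p x) this
    · rfl
  · rw [fiberCond_apply h]
    split_ifs
    · field_simp
    · rw [mul_zero]

open Classical in
theorem min_mul_sum_abs_fiberCond_le (L : X → X) (p q : stdSimplex ℝ X) (v : X) :
    min (stdSimplex.map L p v) (stdSimplex.map L q v)
        * ∑ x, |fiberCond L p v x - fiberCond L q v x|
      ≤ (∑ x with L x = v, |p x - q x|) + |stdSimplex.map L p v - stdSimplex.map L q v| := by
  wlog h : stdSimplex.map L p v ≤ stdSimplex.map L q v generalizing p q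
  · simpa only [abs_sub_comm, min_comm] using this q p (le_of_not_ge h)
  rw [min_eq_left h, abs_sub_comm, abs_of_nonneg (sub_nonneg.2 h), Finset.mul_sum,
    Finset.sum_filter]
  calc ∑ x, stdSimplex.map L p v * |fiberCond L p v x - fiberCond L q v x|
      ≤ ∑ x, ((if L x = v then |p x - q x| else 0)
          + (stdSimplex.map L q v - stdSimplex.map L p v) * fiberCond L q v x) := by
        refine Finset.sum_le_sum fun x _ => ?_
        have hp := stdSimplex_map_mul_fiberCond L p v x
        have hq := stdSimplex_map_mul_fiberCond L q v x
        have h0 : 0 ≤ (stdSimplex.map L q v - stdSimplex.map L p v) * fiberCond L q v x :=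
          mul_nonneg (sub_nonneg.2 h) (stdSimplex.zero_le _ _)
        calc stdSimplex.map L p v * |fiberCond L p v x - fiberCond L q v x|
            = |stdSimplex.map L p v * fiberCond L p v x - stdSimplex.map L q v * fiberCond L q v x
              + (stdSimplex.map L q v - stdSimplex.map L p v) * fiberCond L q v x| := by
              rw [← abs_of_nonneg (stdSimplex.zero_le (stdSimplex.map L p) v), ← abs_mul,
                abs_of_nonneg (stdSimplex.zero_le (stdSimplex.map L p) v)]
              congr 1
              ring
          _ ≤ _ := abs_add_le _ _
          _ = _ := by
              rw [hp, hq, abs_of_nonneg h0]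
              split_ifs <;> simp
    _ = _ := by
        rw [Finset.sum_add_distrib, ← Finset.mul_sum, stdSimplex.sum_eq_one, mul_one]

variable {Ω Ω' : Type*} {S : stdSimplex ℝ X → Ω' → X} {C : ℝ}

/-- Refine a random fiber `z` of `L` to a random point with law `p`. -/
def refineSample (S : stdSimplex ℝ X → Ω' → X) (L : X → X) (p : stdSimplex ℝ X) (z : Ω → X)
    (ω : Ω × Ω') : X :=
  S (fiberCond L p (z ω.1)) ω.2

theorem preimage_refineSample (L : X → X) (p : stdSimplex ℝ X) (z : Ω → X) (x : X) :
    refineSample S L p z ⁻¹' {x} = ⋃ v, (z ⁻¹' {v}) ×ˢ (S (fiberCond L p v) ⁻¹' {x}) := by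
  ext ω
  simp [refineSample]

variable [MeasurableSpace X] [MeasurableSpace Ω'] {ν : Measure Ω'}

theorem refineSample_support (hS : IsSampler ν S C) {L : X → X} {p : stdSimplex ℝ X}
    {z : Ω → X} (hz : ∀ ω, stdSimplex.map L p (z ω) ≠ 0) (ω : Ω × Ω') :
    L (refineSample S L p z ω) = z ω.1 ∧ p (refineSample S L p z ω) ≠ 0 := by
  classical
  have h := hS.support (fiberCond L p (z ω.1)) ω.2
  rw [fiberCond_apply (hz ω.1)] at h
  change (if L (refineSample S L p z ω) = z ω.1 then
    p (refineSample S L p z ω) / stdSimplex.map L p (z ω.1) else 0) ≠ 0 at h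
  split_ifs at h with h1
  · exact ⟨h1, fun h0 => h (by rw [h0, zero_div])⟩
  · exact absurd rfl h

variable [MeasurableSpace Ω] {μ : Measure Ω}

theorem measurable_refineSample [MeasurableSingletonClass X] (hS : IsSampler ν S C)
    (L : X → X) (p : stdSimplex ℝ X)
    {z : Ω → X} (hz : Measurable z) : Measurable (refineSample S L p z) := by
  refine measurable_to_countable' fun x => ?_
  rw [preimage_refineSample]
  exact MeasurableSet.iUnion fun v =>
    (hz (.singleton v)).prod (hS.measurable _ (.singleton x))

theorem real_preimage_refineSample [MeasurableSingletonClass X] [IsProbabilityMeasure μ]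
    [IsProbabilityMeasure ν] (hS : IsSampler ν S C) {L : X → X} {p : stdSimplex ℝ X}
    {z : Ω → X} (hz : Measurable z) (hlaw : ∀ v, μ.real (z ⁻¹' {v}) = stdSimplex.map L p v)
    (x : X) : (μ.prod ν).real (refineSample S L p z ⁻¹' {x}) = p x := by
  classical
  rw [preimage_refineSample, measureReal_iUnion_fintype]
  · simp_rw [measureReal_prod_prod, hlaw, hS.law, stdSimplex_map_mul_fiberCond]
    simp
  · intro v w hvw
    refine Disjoint.set_prod_left ?_ _ _
    exact Disjoint.preimage _ (by simpa using hvw)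
  · exact fun v => (hz (.singleton v)).prod (hS.measurable _ (.singleton x))

theorem real_refineSample_ne_le [IsProbabilityMeasure μ] [IsProbabilityMeasure ν]
    (hS : IsSampler ν S C) (hC : 0 ≤ C) {L : X → X}
    {p q : stdSimplex ℝ X} {z z' : Ω → X}
    (hlaw : ∀ v, μ.real (z ⁻¹' {v}) = stdSimplex.map L p v)
    (hlaw' : ∀ v, μ.real (z' ⁻¹' {v}) = stdSimplex.map L q v) :
    (μ.prod ν).real {ω | z ω.1 = z' ω.1 ∧ refineSample S L p z ω ≠ refineSample S L q z' ω}
      ≤ C * ((∑ x, |p x - q x|)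
        + ∑ x, |stdSimplex.map L p x - stdSimplex.map L q x|) := by
  classical
  have hsub : {ω : Ω × Ω' | z ω.1 = z' ω.1 ∧
      refineSample S L p z ω ≠ refineSample S L q z' ω} ⊆
      ⋃ v, (z ⁻¹' {v} ∩ z' ⁻¹' {v}) ×ˢ {ω | S (fiberCond L p v) ω ≠ S (fiberCond L q v) ω} := by
    rintro ω ⟨h1, h2⟩
    refine mem_iUnion.2 ⟨z ω.1, ⟨rfl, h1.symm⟩, ?_⟩
    simp only [refineSample, ← h1] at h2
    exact h2
  calc _ ≤ _ := measureReal_mono hsub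
    _ ≤ _ := measureReal_iUnion_fintype_le _
    _ ≤ ∑ v, C * ((∑ x with L x = v, |p x - q x|)
          + |stdSimplex.map L p v - stdSimplex.map L q v|) := by
        refine Finset.sum_le_sum fun v _ => ?_
        rw [measureReal_prod_prod]
        calc _ ≤ min (stdSimplex.map L p v) (stdSimplex.map L q v)
              * (C * ∑ x, |fiberCond L p v x - fiberCond L q v x|) := by
              gcongr
              · exact le_min (stdSimplex.zero_le _ _) (stdSimplex.zero_le _ _)
              · refine le_min ?_ ?_
                · rw [← hlaw]
                  exact measureReal_mono inter_subset_left
                · rw [← hlaw']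
                  exact measureReal_mono inter_subset_right
              · exact hS.ne_le _ _
          _ = C * (min (stdSimplex.map L p v) (stdSimplex.map L q v)
              * ∑ x, |fiberCond L p v x - fiberCond L q v x|) := by ring
          _ ≤ _ := mul_le_mul_of_nonneg_left (min_mul_sum_abs_fiberCond_le L p q v) hC
    _ = _ := by
        rw [← Finset.mul_sum, Finset.sum_add_distrib,
          Finset.sum_fiberwise Finset.univ L fun x => |p x - q x|]

/-- The `ℓ¹` distance between the images of two probability vectors under `L`. -/
def mapDist (L : X → X) (p q : stdSimplex ℝ X) : ℝ :=
  ∑ x, |stdSimplex.map L p x - stdSimplex.map L q x|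

/-- `Z` samples the images under `L N` of all probability vectors, and for `j < N` the probability
that two samples are separated by `L (j + 1)` but not by `L j` is controlled. -/
structure IsChainSampler (μ : Measure Ω) (L : ℕ → X → X) (N : ℕ)
    (Z : stdSimplex ℝ X → Ω → X) (C : ℝ) : Prop where
  measurable : ∀ p, Measurable (Z p)
  support : ∀ (p : stdSimplex ℝ X) ω, stdSimplex.map (L N) p (Z p ω) ≠ 0
  law : ∀ (p : stdSimplex ℝ X) x, μ.real (Z p ⁻¹' {x}) = stdSimplex.map (L N) p x
  split_le : ∀ (p q : stdSimplex ℝ X), ∀ j < N,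
    μ.real {ω | L j (Z p ω) = L j (Z q ω) ∧ L (j + 1) (Z p ω) ≠ L (j + 1) (Z q ω)}
      ≤ C * (mapDist (L (j + 1)) p q + mapDist (L j) p q)

theorem isChainSampler_zero [Nonempty X] {L : ℕ → X → X} (h0 : ∀ x y, L 0 x = L 0 y) :
    IsChainSampler (Measure.dirac ()) L 0 (fun _ _ => L 0 (Classical.arbitrary X)) C := by
  classical
  have hmap (p : stdSimplex ℝ X) (x : X) : stdSimplex.map (L 0) p x
      = if L 0 (Classical.arbitrary X) = x then 1 else 0 := by
    rw [stdSimplex_map_apply]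
    simp_rw [h0 _ (Classical.arbitrary X)]
    split_ifs with h <;> simp [h]
  refine ⟨fun p => measurable_const, fun p ω => by simp [hmap], fun p x => ?_, by simp⟩
  rw [hmap]
  split_ifs with h
  · simp [h]
  · simp [h]

theorem IsChainSampler.succ [MeasurableSingletonClass X] [IsProbabilityMeasure μ]
    [IsProbabilityMeasure ν] {L : ℕ → X → X} {N : ℕ} {Z : stdSimplex ℝ X → Ω → X}
    (hZ : IsChainSampler μ L N Z C) (hS : IsSampler ν S C) (hC : 0 ≤ C)
    (hL : ∀ i j, i ≤ j → j ≤ N + 1 → ∀ x, L i (L j x) = L i x) :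
    IsChainSampler (μ.prod ν) L (N + 1)
      (fun p => refineSample S (L N) (stdSimplex.map (L (N + 1)) p) (Z p)) C := by
  have hmap (p : stdSimplex ℝ X) :
      stdSimplex.map (L N) (stdSimplex.map (L (N + 1)) p) = stdSimplex.map (L N) p :=
    stdSimplex_map_map_of_comp (hL N (N + 1) N.le_succ le_rfl) p
  have hsupp (p : stdSimplex ℝ X) (ω : Ω) :
      stdSimplex.map (L N) (stdSimplex.map (L (N + 1)) p) (Z p ω) ≠ 0 := by
    rw [hmap]
    exact hZ.support p ω
  have hlaw (p : stdSimplex ℝ X) (v : X) :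
      μ.real (Z p ⁻¹' {v}) = stdSimplex.map (L N) (stdSimplex.map (L (N + 1)) p) v := by
    rw [hmap]
    exact hZ.law p v
  have hproj (p : stdSimplex ℝ X) (ω : Ω × Ω') :
      L N (refineSample S (L N) (stdSimplex.map (L (N + 1)) p) (Z p) ω) = Z p ω.1 :=
    (refineSample_support hS (hsupp p) ω).1
  refine ⟨fun p => measurable_refineSample hS _ _ (hZ.measurable p),
    fun p ω => (refineSample_support hS (hsupp p) ω).2,
    fun p x => real_preimage_refineSample hS (hZ.measurable p) (hlaw p) x, fun p q j hj => ?_⟩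
  rcases Nat.lt_succ_iff_lt_or_eq.1 hj with hj | rfl
  · have hi (i : ℕ) (hi : i ≤ N) (p : stdSimplex ℝ X) (ω : Ω × Ω') :
        L i (refineSample S (L N) (stdSimplex.map (L (N + 1)) p) (Z p) ω) = L i (Z p ω.1) := by
      rw [← hL i N hi N.le_succ, hproj]
    simp only [hi j hj.le, hi (j + 1) hj]
    refine le_trans (le_of_eq ?_) (hZ.split_le p q j hj)
    have := measureReal_prod_prod (μ := μ) (ν := ν)
      {ω | L j (Z p ω) = L j (Z q ω) ∧ L (j + 1) (Z p ω) ≠ L (j + 1) (Z q ω)} univ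
    rw [probReal_univ, mul_one] at this
    rw [← this]
    congr 1
    ext ω
    simp
  · refine le_trans (measureReal_mono ?_)
      ((real_refineSample_ne_le hS hC (hlaw p) (hlaw q)).trans (le_of_eq ?_))
    · rintro ω ⟨h1, h2⟩
      rw [hproj, hproj] at h1
      exact ⟨h1, fun h => h2 (by rw [h])⟩
    · rw [hmap, hmap]
      rfl

end Refinement

theorem exists_isChainSampler {X : Type*} [Fintype X] [Nonempty X] [MeasurableSpace X]
    [MeasurableSingletonClass X] {C : ℝ} (hC : 1 < C) (N : ℕ) :
    ∃ (Ω : Type) (_ : MeasurableSpace Ω) (_ : StandardBorelSpace Ω) (μ : Measure Ω)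
      (_ : IsProbabilityMeasure μ), ∀ L : ℕ → X → X, (∀ x y, L 0 x = L 0 y) →
        (∀ i j, i ≤ j → j ≤ N → ∀ x, L i (L j x) = L i x) →
        ∃ Z : stdSimplex ℝ X → Ω → X, IsChainSampler μ L N Z C := by
  obtain ⟨Ω', _, _, ν, _, S, hS⟩ := IsSampler.exists_of_one_lt (X := X) hC
  induction N with
  | zero =>
    exact ⟨Unit, inferInstance, inferInstance, Measure.dirac (), inferInstance,
      fun L h0 _ => ⟨_, isChainSampler_zero h0⟩⟩
  | succ N ih =>
    obtain ⟨Ω, _, _, μ, _, h⟩ := ih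
    refine ⟨Ω × Ω', inferInstance, inferInstance, μ.prod ν, inferInstance, fun L h0 hL => ?_⟩
    obtain ⟨Z, hZ⟩ := h L h0 fun i j hij hj => hL i j hij (hj.trans N.le_succ)
    exact ⟨_, hZ.succ hS (by linarith) hL⟩

section Threshold

variable {X : Type*} [MetricSpace X]

/-- The graph joining distinct points at distance at most `t`. -/
def thresholdGraph (X : Type*) [MetricSpace X] (t : ℝ) : SimpleGraph X where
  Adj x y := x ≠ y ∧ dist x y ≤ t
  symm := ⟨fun x y h => ⟨h.1.symm, by rw [dist_comm]; exact h.2⟩⟩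
  loopless := ⟨fun x h => h.1 rfl⟩

theorem thresholdGraph_mono {s t : ℝ} (h : s ≤ t) : thresholdGraph X s ≤ thresholdGraph X t :=
  fun _ _ hxy => ⟨hxy.1, hxy.2.trans h⟩

theorem dist_le_of_walk {t : ℝ} {x y : X} (w : (thresholdGraph X t).Walk x y) :
    dist x y ≤ w.length * t := by
  induction w with
  | nil => simp
  | cons h w ih =>
    rw [SimpleGraph.Walk.length_cons]
    push_cast
    linarith [dist_triangle _ _ _ |>.trans (add_le_add h.2 ih)]

theorem dist_le_of_reachable [Fintype X] {t : ℝ} (ht : 0 ≤ t) {x y : X}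
    (h : (thresholdGraph X t).Reachable x y) : dist x y ≤ ((Fintype.card X : ℝ) - 1) * t := by
  classical
  obtain ⟨w⟩ := h
  have hlen := w.bypass_isPath.length_lt
  refine (dist_le_of_walk w.bypass).trans (mul_le_mul_of_nonneg_right ?_ ht)
  rw [le_sub_iff_add_le]
  exact_mod_cast hlen

/-- The components of the threshold graphs form a nested family of partitions which approximates
`dist ^ q` up to the factor `(|X| - 1) ^ q`. -/
theorem exists_threshold_labels [Fintype X] [Nonempty X] {q : ℝ} (hq : 0 < q) :
    ∃ L : ℝ → X → X,
      (∀ T x y, dist x y ^ q ≤ T → L T x = L T y) ∧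
      (∀ T, 0 ≤ T → ∀ x y, L T x = L T y → dist x y ^ q ≤ ((Fintype.card X : ℝ) - 1) ^ q * T) ∧
      ∀ S T, 0 ≤ S → S ≤ T → ∀ x, L T (L S x) = L T x := by
  have hcard : (0 : ℝ) ≤ (Fintype.card X : ℝ) - 1 := by
    rw [sub_nonneg]
    exact_mod_cast Fintype.card_pos
  let G (T : ℝ) := thresholdGraph X (T ^ q⁻¹)
  let L (T : ℝ) (x : X) : X := ((G T).connectedComponentMk x).out
  have hout (T : ℝ) (x : X) : (G T).Reachable (L T x) x :=
    SimpleGraph.ConnectedComponent.exact (Quot.out_eq ((G T).connectedComponentMk x))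
  have heq {T : ℝ} {x y : X} (h : (G T).Reachable x y) : L T x = L T y := by
    simp only [L]
    rw [SimpleGraph.ConnectedComponent.sound h]
  refine ⟨L, fun T x y h => ?_, fun T hT x y h => ?_, fun S T hS hST x => ?_⟩
  · by_cases hxy : x = y
    · rw [hxy]
    · refine heq (SimpleGraph.Adj.reachable ⟨hxy, ?_⟩)
      rw [← Real.rpow_rpow_inv dist_nonneg hq.ne']
      exact Real.rpow_le_rpow (by positivity) h (by positivity)
  · have hr : (G T).Reachable x y := (hout T x).symm.trans (by rw [h]; exact hout T y)
    calc dist x y ^ q ≤ (((Fintype.card X : ℝ) - 1) * T ^ q⁻¹) ^ q :=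
          Real.rpow_le_rpow dist_nonneg (dist_le_of_reachable (by positivity) hr) hq.le
      _ = _ := by
          rw [Real.mul_rpow hcard (by positivity), Real.rpow_inv_rpow hT hq.ne']
  · exact heq ((hout S x).mono
      (thresholdGraph_mono (Real.rpow_le_rpow hS hST (inv_nonneg.2 hq.le))))

end Threshold

section GeometricSums

open Finset

theorem sum_geometric_lt_le {r : ℝ} (hr0 : 0 ≤ r) (hr1 : r < 1) (n : ℕ) {a c : ℝ} (ha : 0 ≤ a)
    (hc : 0 ≤ c) :
    ∑ i ∈ range n, (if a * r ^ i < c then a * r ^ i else 0) ≤ min a c / (1 - r) := by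
  have h1 : 0 < 1 - r := sub_pos.2 hr1
  induction n generalizing a with
  | zero =>
    rw [sum_range_zero]
    have := le_min ha hc
    positivity
  | succ n ih =>
    have h := ih (mul_nonneg ha hr0)
    simp only [mul_assoc, ← pow_succ'] at h
    rw [sum_range_succ', pow_zero, mul_one]
    by_cases hac : a < c
    · rw [if_pos hac, min_eq_left hac.le]
      have h2 : min (a * r) c / (1 - r) ≤ a * r / (1 - r) := by
        gcongr
        exact min_le_left _ _
      have h3 : a * r / (1 - r) + a = a / (1 - r) := by
        field_simp
        ring
      linarith
    · rw [if_neg hac, add_zero, min_eq_right (not_lt.1 hac)]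
      refine h.trans ?_
      gcongr
      exact min_le_right _ _

theorem sum_range_sum_range_add_mul (h : ℕ → ℝ) (m n : ℕ) :
    ∑ s ∈ range m, ∑ k ∈ range n, h (s + m * k) = ∑ i ∈ range (m * n), h i := by
  rw [sum_comm]
  induction n with
  | zero => simp
  | succ n ih =>
    rw [sum_range_succ, ih, mul_add_one, sum_range_add]
    simp only [add_comm]

theorem sum_sum_geometric_split_le {r : ℝ} (hr0 : 0 < r) (hr1 : r < 1) (m N : ℕ) {A c : ℝ}
    (hA : 0 ≤ A) (hc : 0 ≤ c) :
    ∑ s ∈ range m, ∑ k ∈ range N, A * r ^ (s + m * k)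
        * ((if A * r ^ (s + m * (k + 1)) < c then 1 else 0)
          + if A * r ^ (s + m * k) < c then 1 else 0)
      ≤ ((r ^ m)⁻¹ + 1) * (c / (1 - r)) := by
  set h : ℕ → ℝ := fun i => if A * r ^ i < c then A * r ^ i else 0 with hh
  have hnn (i : ℕ) : 0 ≤ h i := by
    simp only [hh]
    split_ifs <;> positivity
  have hterm (s k : ℕ) : A * r ^ (s + m * k)
        * ((if A * r ^ (s + m * (k + 1)) < c then 1 else 0)
          + if A * r ^ (s + m * k) < c then 1 else 0)
      = (r ^ m)⁻¹ * h (s + m * (k + 1)) + h (s + m * k) := by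
    have : A * r ^ (s + m * k) = (r ^ m)⁻¹ * (A * r ^ (s + m * (k + 1))) := by
      rw [mul_add_one, ← add_assoc, pow_add r _ m]
      field_simp
    simp only [hh, mul_add, mul_ite, mul_one, mul_zero]
    congr 1
    simp only [← mul_add_one, ← this]
  have hshift (s : ℕ) :
      ∑ k ∈ range N, h (s + m * (k + 1)) ≤ ∑ k ∈ range (N + 1), h (s + m * k) := by
    rw [sum_range_succ']
    linarith [hnn (s + m * 0)]
  have hdrop (s : ℕ) : ∑ k ∈ range N, h (s + m * k) ≤ ∑ k ∈ range (N + 1), h (s + m * k) := by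
    rw [sum_range_succ]
    linarith [hnn (s + m * N)]
  have htot : ∑ s ∈ range m, ∑ k ∈ range (N + 1), h (s + m * k) ≤ c / (1 - r) := by
    rw [sum_range_sum_range_add_mul]
    refine (sum_geometric_lt_le hr0.le hr1 _ hA hc).trans ?_
    have : 0 < 1 - r := sub_pos.2 hr1
    gcongr
    exact min_le_right _ _
  simp_rw [hterm, sum_add_distrib, ← mul_sum]
  rw [add_mul, one_mul]
  refine add_le_add ?_ ((sum_le_sum fun s _ => hdrop s).trans htot)
  exact mul_le_mul_of_nonneg_left ((sum_le_sum fun s _ => hshift s).trans htot) (by positivity)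

end GeometricSums

section Cost

variable {X : Type*} [Fintype X]

open Classical in
theorem mapDist_le_of_coupling (L : X → X) {p q : stdSimplex ℝ X} {g : X × X → ℝ}
    (hg : ∀ z, 0 ≤ g z) (hp : ∀ x, p x = ∑ z with z.1 = x, g z)
    (hq : ∀ x, q x = ∑ z with z.2 = x, g z) :
    mapDist L p q ≤ 2 * ∑ z, (if L z.1 ≠ L z.2 then 1 else 0) * g z := by
  have hmap {u : stdSimplex ℝ X} {f : X × X → X} (hu : ∀ x, u x = ∑ z with f z = x, g z)
      (w : X) : stdSimplex.map L u w = ∑ z, (if L (f z) = w then 1 else 0) * g z := by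
    rw [stdSimplex_map_apply]
    simp_rw [hu, Finset.sum_filter, ← Finset.sum_filter, Finset.sum_filter]
    calc ∑ x, (if L x = w then ∑ z, (if f z = x then g z else 0) else 0)
        = ∑ x, ∑ z, if f z = x then (if L (f z) = w then 1 else 0) * g z else 0 := by
          refine Finset.sum_congr rfl fun x _ => ?_
          split_ifs with h
          · refine Finset.sum_congr rfl fun z _ => ?_
            split_ifs with h1 h2
            · rw [one_mul]
            · exact absurd (by rw [h1]; exact h) h2
            · rfl
          · symm
            refine Finset.sum_eq_zero fun z _ => ?_
            split_ifs with h1 h2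
            · exact absurd (by rw [← h1]; exact h2) h
            · rw [zero_mul]
            · rfl
      _ = _ := by
          rw [Finset.sum_comm]
          simp
  have hpt (z : X × X) :
      ∑ w, |(if L z.1 = w then (1 : ℝ) else 0) - if L z.2 = w then 1 else 0|
        ≤ 2 * if L z.1 ≠ L z.2 then 1 else 0 := by
    by_cases h : L z.1 = L z.2
    · simp [h]
    · rw [if_pos h]
      calc _ ≤ ∑ w, ((if L z.1 = w then (1 : ℝ) else 0) + if L z.2 = w then 1 else 0) := by
            refine Finset.sum_le_sum fun w _ => ?_
            split_ifs <;> norm_num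
        _ = _ := by
            rw [Finset.sum_add_distrib]
            norm_num
  calc mapDist L p q
      = ∑ w, |∑ z, ((if L z.1 = w then (1 : ℝ) else 0) - if L z.2 = w then 1 else 0) * g z| := by
        simp_rw [mapDist, hmap hp, hmap hq, ← Finset.sum_sub_distrib, ← sub_mul]
    _ ≤ ∑ w, ∑ z, |(if L z.1 = w then (1 : ℝ) else 0) - if L z.2 = w then 1 else 0| * g z := by
        refine Finset.sum_le_sum fun w _ => (Finset.abs_sum_le_sum_abs _ _).trans (le_of_eq ?_)
        simp_rw [abs_mul, abs_of_nonneg (hg _)]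
    _ ≤ ∑ z, (2 * if L z.1 ≠ L z.2 then 1 else 0) * g z := by
        rw [Finset.sum_comm]
        refine Finset.sum_le_sum fun z _ => ?_
        rw [← Finset.sum_mul]
        exact mul_le_mul_of_nonneg_right (hpt z) (hg z)
    _ = _ := by
        rw [Finset.mul_sum]
        simp_rw [mul_assoc]

open Classical in
theorem sum_sum_mapDist_le {L : ℝ → X → X} {c : X → X → ℝ} (hc : ∀ x y, 0 ≤ c x y)
    (hL : ∀ T x y, c x y ≤ T → L T x = L T y) {p q : stdSimplex ℝ X} {g : X × X → ℝ}
    (hg : ∀ z, 0 ≤ g z) (hp : ∀ x, p x = ∑ z with z.1 = x, g z)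
    (hq : ∀ x, q x = ∑ z with z.2 = x, g z) {r : ℝ} (hr0 : 0 < r) (hr1 : r < 1) (m N : ℕ)
    {A : ℝ} (hA : 0 ≤ A) :
    ∑ s ∈ Finset.range m, ∑ k ∈ Finset.range N, A * r ^ (s + m * k)
        * (mapDist (L (A * r ^ (s + m * (k + 1)))) p q + mapDist (L (A * r ^ (s + m * k))) p q)
      ≤ 2 * ((r ^ m)⁻¹ + 1) / (1 - r) * ∑ z, c z.1 z.2 * g z := by
  have hdist (T : ℝ) : mapDist (L T) p q ≤ 2 * ∑ z, (if T < c z.1 z.2 then 1 else 0) * g z := by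
    refine (mapDist_le_of_coupling (L T) hg hp hq).trans ?_
    refine mul_le_mul_of_nonneg_left (Finset.sum_le_sum fun z _ =>
      mul_le_mul_of_nonneg_right ?_ (hg z)) zero_le_two
    split_ifs with h1 h2
    · rfl
    · exact absurd (hL T _ _ (not_lt.1 h2)) h1
    · exact zero_le_one
    · rfl
  calc _ ≤ ∑ s ∈ Finset.range m, ∑ k ∈ Finset.range N, A * r ^ (s + m * k)
        * (2 * ∑ z, (if A * r ^ (s + m * (k + 1)) < c z.1 z.2 then 1 else 0) * g z
          + 2 * ∑ z, (if A * r ^ (s + m * k) < c z.1 z.2 then 1 else 0) * g z) := by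
        gcongr
        · exact hdist _
        · exact hdist _
    _ = 2 * ∑ z, (∑ s ∈ Finset.range m, ∑ k ∈ Finset.range N, A * r ^ (s + m * k)
        * ((if A * r ^ (s + m * (k + 1)) < c z.1 z.2 then 1 else 0)
          + if A * r ^ (s + m * k) < c z.1 z.2 then 1 else 0)) * g z := by
        simp_rw [Finset.sum_mul]
        rw [Finset.sum_comm (s := Finset.univ), Finset.mul_sum]
        refine Finset.sum_congr rfl fun s _ => ?_
        rw [Finset.sum_comm (s := Finset.univ), Finset.mul_sum]
        refine Finset.sum_congr rfl fun k _ => ?_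
        rw [← mul_add, ← Finset.sum_add_distrib, mul_left_comm, Finset.mul_sum]
        congr 1
        refine Finset.sum_congr rfl fun z _ => ?_
        ring
    _ ≤ 2 * ∑ z : X × X, ((r ^ m)⁻¹ + 1) * (c z.1 z.2 / (1 - r)) * g z := by
        gcongr with z
        · exact hg z
        · exact sum_sum_geometric_split_le hr0 hr1 m N hA (hc _ _)
    _ = _ := by
        rw [Finset.mul_sum, Finset.mul_sum]
        refine Finset.sum_congr rfl fun z _ => ?_
        ring

variable [MeasurableSpace X] [MeasurableSingletonClass X] {Ω : Type*} [MeasurableSpace Ω]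
  {μ : Measure Ω}

theorem IsChainSampler.lintegral_cost_le [IsProbabilityMeasure μ] {L : ℕ → X → X} {N : ℕ}
    {Z : stdSimplex ℝ X → Ω → X} {C : ℝ} (hZ : IsChainSampler μ L N Z C) {c : X → X → ℝ}
    (hc0 : ∀ x, c x x = 0) {T : ℕ → ℝ} (hT : ∀ k, 0 ≤ T k) {M : ℝ} (hM : 0 ≤ M)
    (h0 : ∀ x y, L 0 x = L 0 y) (hN : Function.Injective (L N))
    (hcM : ∀ k x y, L k x = L k y → c x y ≤ M * T k) (p q : stdSimplex ℝ X) :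
    ∫⁻ ω, ENNReal.ofReal (c (Z p ω) (Z q ω)) ∂μ
      ≤ ENNReal.ofReal (M * C * ∑ k ∈ Finset.range N,
          T k * (mapDist (L (k + 1)) p q + mapDist (L k) p q)) := by
  classical
  let A (k : ℕ) : Set Ω :=
    {ω | L k (Z p ω) = L k (Z q ω) ∧ L (k + 1) (Z p ω) ≠ L (k + 1) (Z q ω)}
  have hA (k : ℕ) : MeasurableSet (A k) :=
    ((hZ.measurable p).prodMk (hZ.measurable q))
      (Set.toFinite {z : X × X | L k z.1 = L k z.2 ∧ L (k + 1) z.1 ≠ L (k + 1) z.2}).measurableSet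
  have hpt (ω : Ω) : ENNReal.ofReal (c (Z p ω) (Z q ω))
      ≤ ∑ k ∈ Finset.range N, (A k).indicator (fun _ => ENNReal.ofReal (M * T k)) ω := by
    by_cases h : Z p ω = Z q ω
    · simp [h, hc0]
    · obtain ⟨k, hkN, hk, hk1⟩ : ∃ k < N, L k (Z p ω) = L k (Z q ω) ∧
          L (k + 1) (Z p ω) ≠ L (k + 1) (Z q ω) := by
        by_contra! hcon
        have hall (k : ℕ) : k ≤ N → L k (Z p ω) = L k (Z q ω) := by
          induction k with
          | zero => exact fun _ => h0 _ _
          | succ k ih => exact fun hk => hcon k hk (ih (by omega))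
        exact h (hN (hall N le_rfl))
      calc ENNReal.ofReal (c (Z p ω) (Z q ω)) ≤ ENNReal.ofReal (M * T k) :=
            ENNReal.ofReal_le_ofReal (hcM k _ _ hk)
        _ = (A k).indicator (fun _ => ENNReal.ofReal (M * T k)) ω :=
            (Set.indicator_of_mem (show ω ∈ A k from ⟨hk, hk1⟩)
              (fun _ => ENNReal.ofReal (M * T k))).symm
        _ ≤ _ := Finset.single_le_sum
            (f := fun k => (A k).indicator (fun _ => ENNReal.ofReal (M * T k)) ω)
            (fun _ _ => zero_le) (Finset.mem_range.2 hkN)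
  calc _ ≤ ∫⁻ ω, ∑ k ∈ Finset.range N,
        (A k).indicator (fun _ => ENNReal.ofReal (M * T k)) ω ∂μ := lintegral_mono hpt
    _ = ∑ k ∈ Finset.range N, ENNReal.ofReal (M * T k) * μ (A k) := by
        rw [lintegral_finsetSum _ fun k _ => measurable_const.indicator (hA k)]
        simp_rw [lintegral_indicator_const (hA _)]
    _ ≤ ∑ k ∈ Finset.range N, ENNReal.ofReal (M * T k
          * (C * (mapDist (L (k + 1)) p q + mapDist (L k) p q))) := by
        refine Finset.sum_le_sum fun k hk => ?_
        rw [← ofReal_measureReal, ← ENNReal.ofReal_mul (mul_nonneg hM (hT k))]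
        exact ENNReal.ofReal_le_ofReal (mul_le_mul_of_nonneg_left
          (hZ.split_le p q k (Finset.mem_range.1 hk)) (mul_nonneg hM (hT k)))
    _ = _ := by
        rw [← ENNReal.ofReal_sum_of_nonneg, Finset.mul_sum]
        · congr 1
          refine Finset.sum_congr rfl fun k _ => ?_
          ring
        · intro k hk
          exact mul_nonneg (mul_nonneg hM (hT k))
            (measureReal_nonneg.trans (hZ.split_le p q k (Finset.mem_range.1 hk)))

end Cost

section Transfer

theorem exists_measurable_stdSpace_map_eq {Y : Type*} [MeasurableSpace Y] [StandardBorelSpace Y]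
    (μ : Measure Y) [IsProbabilityMeasure μ] :
    ∃ g : ℝ → Y, Measurable g ∧ stdSpace.map g = μ := by
  have : Nonempty Y := nonempty_of_isProbabilityMeasure μ
  obtain ⟨f, hf, hfμ⟩ := Measure.exists_measurable_map_eq μ
  have hproj : Measurable (projIcc (0 : ℝ) 1 zero_le_one) := continuous_projIcc.measurable
  have hvol : stdSpace.map (projIcc (0 : ℝ) 1 zero_le_one) = (volume : Measure unitInterval) := by
    rw [stdSpace, ← map_comap_subtype_coe measurableSet_Icc,
      Measure.map_map hproj measurable_subtype_coe]
    have : projIcc (0 : ℝ) 1 zero_le_one ∘ Subtype.val = id := funext fun x => projIcc_val _ x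
    rw [this, Measure.map_id]
    rfl
  exact ⟨f ∘ projIcc 0 1 zero_le_one, hf.comp hproj, by
    rw [← Measure.map_map hf hproj, hvol, hfμ]⟩

theorem exists_stdSpace_mixture {X Ω ι : Type*} [Finite X] [MeasurableSpace X]
    [MeasurableSingletonClass X] [MeasurableSpace Ω] [StandardBorelSpace Ω] (μ : Measure Ω)
    [IsProbabilityMeasure μ] {m : ℕ} (hm : m ≠ 0) {Z : Fin m → ι → Ω → X}
    (hZ : ∀ s a, Measurable (Z s a)) :
    ∃ f : ι → ℝ → X, (∀ a, Measurable (f a)) ∧ ∀ a b (F : X → X → ℝ≥0∞),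
      ∫⁻ u, F (f a u) (f b u) ∂stdSpace
        = (m : ℝ≥0∞)⁻¹ * ∑ s, ∫⁻ ω, F (Z s a ω) (Z s b ω) ∂μ := by
  have : NeZero m := ⟨hm⟩
  let ν : Measure (Fin m) := (PMF.uniformOfFintype (Fin m)).toMeasure
  have hν (s : Fin m) : ν {s} = (m : ℝ≥0∞)⁻¹ := by
    rw [PMF.toMeasure_apply_singleton _ _ (measurableSet_singleton s),
      PMF.uniformOfFintype_apply, Fintype.card_fin]
  obtain ⟨g, hg, hgμ⟩ := exists_measurable_stdSpace_map_eq (ν.prod μ)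
  have hW (a : ι) : Measurable fun z : Fin m × Ω => Z z.1 a z.2 :=
    measurable_from_prod_countable_right fun s => hZ s a
  refine ⟨fun a u => Z (g u).1 a (g u).2, fun a => (hW a).comp hg, fun a b F => ?_⟩
  have hF : Measurable fun z : Fin m × Ω => F (Z z.1 a z.2) (Z z.1 b z.2) :=
    (measurable_of_finite fun z : X × X => F z.1 z.2).comp ((hW a).prodMk (hW b))
  rw [← lintegral_map (f := fun z : Fin m × Ω => F (Z z.1 a z.2) (Z z.1 b z.2)) hF hg, hgμ,
    lintegral_prod _ hF.aemeasurable, lintegral_fintype, Finset.mul_sum]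
  exact Finset.sum_congr rfl fun s _ => by rw [hν, mul_comm]

end Transfer

section FiniteMetric

open Classical in
theorem measureReal_map_singleton_eq_sum {X Y : Type*} [Fintype X] [MeasurableSpace X]
    [MeasurableSingletonClass X] [MeasurableSpace Y] [MeasurableSingletonClass Y]
    (γ : Measure X) [IsFiniteMeasure γ] {f : X → Y} (hf : Measurable f) (y : Y) :
    (γ.map f).real {y} = ∑ z with f z = y, γ.real {z} := by
  rw [sum_measureReal_singleton, map_measureReal_apply hf (measurableSet_singleton y)]
  congr 1
  ext z
  simp

theorem lintegral_ofReal_eq_ofReal_sum {X : Type*} [Fintype X] [MeasurableSpace X]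
    [MeasurableSingletonClass X] (γ : Measure X) [IsFiniteMeasure γ] {f : X → ℝ}
    (hf : ∀ x, 0 ≤ f x) :
    ∫⁻ x, ENNReal.ofReal (f x) ∂γ = ENNReal.ofReal (∑ x, f x * γ.real {x}) := by
  rw [lintegral_fintype,
    ENNReal.ofReal_sum_of_nonneg fun x _ => mul_nonneg (hf x) measureReal_nonneg]
  exact Finset.sum_congr rfl fun x _ => by rw [ENNReal.ofReal_mul (hf x), ofReal_measureReal]

variable {X : Type*} [Fintype X] [MeasurableSpace X] [MeasurableSingletonClass X]

/-- The vector of point masses of a probability measure on a finite space. -/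
def pointMasses (P : ProbabilityMeasure X) : stdSimplex ℝ X :=
  ⟨fun x => (P : Measure X).real {x}, fun _ => measureReal_nonneg, by
    rw [sum_measureReal_singleton, Finset.coe_univ, probReal_univ]⟩

theorem exists_isCoupling_of_samplers {Ω : Type*} [MeasurableSpace Ω] [StandardBorelSpace Ω]
    (μ : Measure Ω) [IsProbabilityMeasure μ] {m : ℕ} (hm : m ≠ 0)
    {Z : Fin m → stdSimplex ℝ X → Ω → X} (hZ : ∀ s p, Measurable (Z s p))
    (hlaw : ∀ s p x, μ.real (Z s p ⁻¹' {x}) = p x) :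
    ∃ f : ProbabilityMeasure X → ℝ → X,
      IsCoupling (fun P : ProbabilityMeasure X => (P : Measure X)) f ∧
      ∀ P Q (F : X → X → ℝ≥0∞), ∫⁻ u, F (f P u) (f Q u) ∂stdSpace
        = (m : ℝ≥0∞)⁻¹ *
          ∑ s, ∫⁻ ω, F (Z s (pointMasses P) ω) (Z s (pointMasses Q) ω) ∂μ := by
  classical
  obtain ⟨f, hf, hint⟩ := exists_stdSpace_mixture μ hm hZ
  refine ⟨fun P => f (pointMasses P), ⟨fun P => hf _, fun P => ?_⟩, fun P Q F => hint _ _ F⟩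
  refine Measure.ext_iff_singleton.2 fun x => ?_
  have hind {Ω' : Type _} [MeasurableSpace Ω'] (η : Measure Ω') {h : Ω' → X}
      (hh : Measurable h) : η (h ⁻¹' {x}) = ∫⁻ u, ({x} : Set X).indicator 1 (h u) ∂η := by
    rw [← lintegral_indicator_one (hh (measurableSet_singleton x))]
    rfl
  rw [Measure.map_apply (hf _) (measurableSet_singleton x), hind _ (hf _),
    hint _ (pointMasses P) fun y _ => ({x} : Set X).indicator 1 y]
  have hs (s : Fin m) :
      ∫⁻ ω, ({x} : Set X).indicator 1 (Z s (pointMasses P) ω) ∂μ = (P : Measure X) {x} := by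
    rw [← lintegral_map (measurable_of_finite _) (hZ s _), lintegral_indicator_one
      (measurableSet_singleton x), Measure.map_apply (hZ s _) (measurableSet_singleton x),
      ← ofReal_measureReal, hlaw, pointMasses]
    exact ofReal_measureReal
  simp_rw [hs]
  rw [Finset.sum_const, Finset.card_univ, Fintype.card_fin, nsmul_eq_mul, ← mul_assoc,
    ENNReal.inv_mul_cancel (by exact_mod_cast hm) (ENNReal.natCast_ne_top m), one_mul]

end FiniteMetric

theorem optRatio_le_of_isCoupling {X A : Type*} [MeasurableSpace X] {c : X → X → ℝ}
    {P : A → Measure X} {f : A → ℝ → X} (hf : IsCoupling P f) {r : ℝ≥0∞} (hr : 1 ≤ r)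
    (hr' : r ≠ ∞)
    (h : ∀ a b (γ : Measure (X × X)), IsProbabilityMeasure γ → γ.map Prod.fst = P a →
      γ.map Prod.snd = P b → ∫⁻ u, ENNReal.ofReal (c (f a u) (f b u)) ∂stdSpace
        ≤ r * ∫⁻ z, ENNReal.ofReal (c z.1 z.2) ∂γ) :
    optRatio c P ≤ r := by
  refine (iInf₂_le f hf).trans (sInf_le ⟨hr, fun a b => ?_⟩)
  have hr0 : r ≠ 0 := (zero_lt_one.trans_le hr).ne'
  simp_rw [Cstar, ENNReal.mul_iInf_of_ne hr0 hr']
  exact le_iInf₂ fun γ hγ => h a b γ hγ.1 hγ.2.1 hγ.2.2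

theorem exists_isCoupling_lintegral_le {X : Type*} [MetricSpace X] [Fintype X] [Nontrivial X]
    [MeasurableSpace X] [BorelSpace X] {q : ℝ} (hq : 0 < q) {r : ℝ} (hr0 : 0 < r) (hr1 : r < 1)
    {m : ℕ} (hm : m ≠ 0) {C : ℝ} (hC : 1 < C) :
    ∃ f : ProbabilityMeasure X → ℝ → X,
      IsCoupling (fun P : ProbabilityMeasure X => (P : Measure X)) f ∧
      ∀ (P Q : ProbabilityMeasure X) (γ : Measure (X × X)), IsProbabilityMeasure γ →
        γ.map Prod.fst = P → γ.map Prod.snd = Q →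
        ∫⁻ u, ENNReal.ofReal (dist (f P u) (f Q u) ^ q) ∂stdSpace
          ≤ ENNReal.ofReal ((m : ℝ)⁻¹ * (((Fintype.card X : ℝ) - 1) ^ q * C
              * (2 * ((r ^ m)⁻¹ + 1) / (1 - r))))
            * ∫⁻ z, ENNReal.ofReal (dist z.1 z.2 ^ q) ∂γ := by
  classical
  set M : ℝ := ((Fintype.card X : ℝ) - 1) ^ q with hMdef
  have hM : 0 ≤ M :=
    Real.rpow_nonneg (sub_nonneg.2 (by exact_mod_cast Fintype.card_pos)) q
  have hc0 (x : X) : dist x x ^ q = 0 := by rw [dist_self, Real.zero_rpow hq.ne']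
  have hcn (x y : X) : 0 ≤ dist x y ^ q := Real.rpow_nonneg dist_nonneg q
  obtain ⟨L, hL, hLM, hLL⟩ := exists_threshold_labels (X := X) hq
  obtain ⟨B, hB⟩ : ∃ B : ℝ, ∀ z : X × X, dist z.1 z.2 ^ q ≤ B := by
    obtain ⟨B, hB⟩ := (Set.finite_range fun z : X × X => dist z.1 z.2 ^ q).bddAbove
    exact ⟨B, fun z => hB ⟨z, rfl⟩⟩
  have hB0 : 0 ≤ B := (hcn (Classical.arbitrary X) (Classical.arbitrary X)).trans (hB (_, _))
  set A : ℝ := B * (r ^ m)⁻¹ with hAdef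
  have hA : 0 ≤ A := by positivity
  have hBA {s : ℕ} (hs : s ≤ m) : B ≤ A * r ^ s := by
    rw [hAdef, mul_assoc, ← div_eq_inv_mul]
    exact le_mul_of_one_le_right hB0
      ((one_le_div (by positivity)).2 (pow_le_pow_of_le_one hr0.le hr1.le hs))
  obtain ⟨N, hN⟩ : ∃ N : ℕ, ∀ z : X × X, z.1 ≠ z.2 → M * (A * r ^ N) < dist z.1 z.2 ^ q := by
    have hlim : Filter.Tendsto (fun N : ℕ => M * (A * r ^ N)) Filter.atTop (nhds 0) := by
      simpa using ((tendsto_pow_atTop_nhds_zero_of_lt_one hr0.le hr1).const_mul A).const_mul M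
    refine Filter.Eventually.exists (f := Filter.atTop) ?_
    refine Filter.eventually_all.2 fun z => ?_
    by_cases hz : z.1 = z.2
    · exact .of_forall fun _ h => absurd hz h
    · filter_upwards [hlim.eventually_lt_const (Real.rpow_pos_of_pos (dist_pos.2 hz) q)]
        with N hN _ using hN
  set T : Fin m → ℕ → ℝ := fun s k => A * r ^ ((s : ℕ) + m * k) with hTdef
  have hT (s k) : 0 ≤ T s k := by positivity
  have hcM (s k) (x y : X) (h : L (T s k) x = L (T s k) y) : dist x y ^ q ≤ M * T s k :=
    hLM _ (hT s k) x y h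
  have hL0 (s) (x y : X) : L (T s 0) x = L (T s 0) y :=
    hL _ x y ((hB (x, y)).trans (by simpa [hTdef] using hBA s.2.le))
  have hchain (s i j) (hij : i ≤ j) (x : X) : L (T s i) (L (T s j) x) = L (T s i) x := by
    refine hLL _ _ (hT s j) ?_ x
    refine mul_le_mul_of_nonneg_left (pow_le_pow_of_le_one hr0.le hr1.le ?_) hA
    exact Nat.add_le_add_left (Nat.mul_le_mul_left m hij) _
  have hinj (s) : Function.Injective (L (T s N)) := by
    intro x y h
    by_contra hxy
    refine (hN (x, y) hxy).not_ge ((hcM s N x y h).trans (mul_le_mul_of_nonneg_left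
      (mul_le_mul_of_nonneg_left (pow_le_pow_of_le_one hr0.le hr1.le ?_) hA) hM))
    exact (Nat.le_mul_of_pos_left N (Nat.pos_of_ne_zero hm)).trans (Nat.le_add_left _ _)
  have hid (s) : L (T s N) = id := funext fun x => hinj s (hchain s N N le_rfl x)
  obtain ⟨Ω, _, _, μ, _, hμ⟩ := exists_isChainSampler (X := X) hC N
  choose Z hZ using fun s : Fin m => hμ (fun k => L (T s k)) (hL0 s)
    fun i j hij _ x => hchain s i j hij x
  obtain ⟨f, hf, hint⟩ := exists_isCoupling_of_samplers μ hm (fun s => (hZ s).measurable)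
    fun s p x => by rw [(hZ s).law, hid, stdSimplex.map_id_apply]
  refine ⟨f, hf, fun P Q γ _ hP hQ => ?_⟩
  rw [hint P Q fun x y => ENNReal.ofReal (dist x y ^ q),
    lintegral_ofReal_eq_ofReal_sum γ fun z : X × X => hcn z.1 z.2]
  set p := pointMasses P with hp
  set p' := pointMasses Q with hp'
  have hpx (x : X) : p x = ∑ z : X × X with z.1 = x, γ.real {z} := by
    rw [← measureReal_map_singleton_eq_sum γ measurable_fst, hP]
    rfl
  have hpx' (x : X) : p' x = ∑ z : X × X with z.2 = x, γ.real {z} := by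
    rw [← measureReal_map_singleton_eq_sum γ measurable_snd, hQ]
    rfl
  have hmap (T : ℝ) : 0 ≤ mapDist (L T) p p' := Finset.sum_nonneg fun _ _ => abs_nonneg _
  have hsum := sum_sum_mapDist_le (c := fun x y : X => dist x y ^ q) hcn hL
    (fun z => measureReal_nonneg (μ := γ)) hpx hpx' hr0 hr1 m N hA
  rw [Finset.sum_range] at hsum
  calc _ ≤ (m : ℝ≥0∞)⁻¹ * ∑ s : Fin m, ENNReal.ofReal (M * C * ∑ k ∈ Finset.range N,
          T s k * (mapDist (L (T s (k + 1))) p p' + mapDist (L (T s k)) p p')) := by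
        gcongr with s
        exact (hZ s).lintegral_cost_le hc0 (hT s) hM (hL0 s) (hinj s) (hcM s) p p'
    _ = ENNReal.ofReal ((m : ℝ)⁻¹ * (M * C * ∑ s : Fin m, ∑ k ∈ Finset.range N,
          T s k * (mapDist (L (T s (k + 1))) p p' + mapDist (L (T s k)) p p'))) := by
        rw [← ENNReal.ofReal_sum_of_nonneg, ENNReal.ofReal_mul (by positivity),
          ENNReal.ofReal_inv_of_pos (by positivity), ENNReal.ofReal_natCast, Finset.mul_sum]
        intro s _
        refine mul_nonneg (by positivity) (Finset.sum_nonneg fun k _ => ?_)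
        exact mul_nonneg (hT s k) (add_nonneg (hmap _) (hmap _))
    _ ≤ ENNReal.ofReal ((m : ℝ)⁻¹ * (M * C * (2 * ((r ^ m)⁻¹ + 1) / (1 - r)
          * ∑ z : X × X, dist z.1 z.2 ^ q * γ.real {z}))) := by
        gcongr
    _ = _ := by
        have : 0 < 1 - r := sub_pos.2 hr1
        rw [← ENNReal.ofReal_mul (by positivity)]
        congr 1
        ring

end Couplings

/-- for a finite metric space `X` with at least two points, `q > 0`,
and the cost `c(x,y) = d(x,y)^q`, the optimal pairwise coupling ratio of the family of
all Borel probability measures on `X` satisfies `r*_c(P(X)) < 7.56 (|X| - 1)^q`. -/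
theorem finite_metric_power_optRatio_lt {X : Type*} [MetricSpace X] [Fintype X] [Nontrivial X]
    [MeasurableSpace X] [BorelSpace X] (q : ℝ) (hq : 0 < q) :
    optRatio (fun x y : X => dist x y ^ q)
        (fun P : ProbabilityMeasure X => (P : Measure X))
      < ENNReal.ofReal (7.56 * ((Fintype.card X : ℝ) - 1) ^ q) := by
  obtain ⟨f, hf, h⟩ := exists_isCoupling_lintegral_le (X := X) hq (r := 19 / 20) (by norm_num)
    (by norm_num) (m := 25) (by norm_num) (C := 1.01) (by norm_num)
  have hM : 1 ≤ ((Fintype.card X : ℝ) - 1) ^ q := by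
    have : (2 : ℝ) ≤ Fintype.card X := by exact_mod_cast Fintype.one_lt_card (α := X)
    exact Real.one_le_rpow (by linarith) hq.le
  refine (optRatio_le_of_isCoupling hf ?_ ENNReal.ofReal_ne_top h).trans_lt ?_
  · rw [ENNReal.one_le_ofReal]
    norm_num
    linarith
  · refine (ENNReal.ofReal_lt_ofReal_iff (by positivity)).2 ?_
    norm_num
    linarith

end
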